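/- arXiv:2406.02839 — 2 statements merged into one kernel-verified Lean document; each statement's English description precedes it below -/
import Mathlib

section
/- Let N ≥ 1, let M be a real symmetric positive definite N×N matrix, and let K and C be real symmetric positive semidefinite N×N matrices. Let Δt > 0, ψ > 0, let (uₙ)ₙ, (vₙ)ₙ be sequences in ℝᴺ, set Ψₙ = ½ vₙᵀ M vₙ + ½ uₙᵀ K uₙ and Θₙ = vₙᵀ C vₙ, and define (Φₙ) by Φ₀ ≥ 0 and Φₙ₊₁ = Φₙ / (1 + Δt · Θₙ₊₁/(Ψₙ₊₁ + ψ)). Fix a natural number β ≥ 1, and set Ξₙ = Φₙ/(Ψₙ + ψ) and Υₙ = 1 − (1 − Ξₙ)^β. Then there exists a real number U > 0 such that for every n, Υₙ² · Ψₙ ≤ U². -/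
open Matrix

/-- If `0 ≤ x ≤ R`, then `1 - (1 - x) ^ n` is at most linear in `x`. -/
lemma abs_one_sub_one_sub_pow_le {x R : ℝ} (hx : 0 ≤ x) (hxR : x ≤ R) (n : ℕ) :
    |1 - (1 - x) ^ n| ≤ x * ∑ i ∈ Finset.range n, (1 + R) ^ i := by
  have habs : |1 - x| ≤ 1 + R := abs_le.2 ⟨by linarith, by linarith⟩
  rw [← mul_neg_geom_sum, sub_sub_cancel, abs_mul, abs_of_nonneg hx]
  gcongr
  refine (Finset.abs_sum_le_sum_abs _ _).trans (Finset.sum_le_sum fun i _ => ?_)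
  rw [abs_pow]
  gcongr

/-- A nonnegative sequence obtained by successive divisions by numbers at least `1` is bounded by
its initial value. -/
lemma nonneg_and_le_of_succ_eq_div {a d : ℕ → ℝ} (ha : 0 ≤ a 0) (hd : ∀ n, 1 ≤ d n)
    (h : ∀ n, a (n + 1) = a n / d n) (n : ℕ) : 0 ≤ a n ∧ a n ≤ a 0 := by
  induction n with
  | zero => exact ⟨ha, le_rfl⟩
  | succ n ih =>
    rw [h]
    exact ⟨div_nonneg ih.1 (zero_le_one.trans (hd n)), (div_le_self ih.1 (hd n)).trans ih.2⟩

/-- Theorem 1, part 2: uniform boundedness of the updated pseudo-energy of the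
IMEX-BDFk-SAV schemes for linear structural dynamics without external forces. -/
theorem sav_energy_bound_linear
    {N : ℕ} (hN : 1 ≤ N)
    (M K C : Matrix (Fin N) (Fin N) ℝ)
    (hM : M.PosDef) (hK : K.PosSemidef) (hC : C.PosSemidef)
    (Δt ψ : ℝ) (hΔt : 0 < Δt) (hψ : 0 < ψ)
    (u v : ℕ → Fin N → ℝ)
    (Ψ Θ Φ : ℕ → ℝ)
    (hΨ : ∀ n, Ψ n = (1/2) * (v n ⬝ᵥ M *ᵥ v n) + (1/2) * (u n ⬝ᵥ K *ᵥ u n))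
    (hΘ : ∀ n, Θ n = v n ⬝ᵥ C *ᵥ v n)
    (hΦ0 : 0 ≤ Φ 0)
    (hΦ : ∀ n, Φ (n+1) = Φ n / (1 + Δt * (Θ (n+1) / (Ψ (n+1) + ψ))))
    (β : ℕ) (hβ : 1 ≤ β)
    (Ξ Υ : ℕ → ℝ)
    (hΞ : ∀ n, Ξ n = Φ n / (Ψ n + ψ))
    (hΥ : ∀ n, Υ n = 1 - (1 - Ξ n) ^ β) :
    ∃ U : ℝ, 0 < U ∧ ∀ n, (Υ n) ^ 2 * Ψ n ≤ U ^ 2 := by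
  have hquad {A : Matrix (Fin N) (Fin N) ℝ} (hA : A.PosSemidef) (x : Fin N → ℝ) :
      0 ≤ x ⬝ᵥ A *ᵥ x := by
    simpa using hA.dotProduct_mulVec_nonneg x
  have hΨ_nonneg (n : ℕ) : 0 ≤ Ψ n := by
    rw [hΨ]
    linarith [hquad hM.posSemidef (v n), hquad hK (u n)]
  have hpos (n : ℕ) : 0 < Ψ n + ψ := by linarith [hΨ_nonneg n]
  have hΘ_nonneg (n : ℕ) : 0 ≤ Θ n := hΘ n ▸ hquad hC (v n)
  have hΦ_bound := nonneg_and_le_of_succ_eq_div hΦ0 (fun n => le_add_of_nonneg_right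
    (mul_nonneg hΔt.le (div_nonneg (hΘ_nonneg (n + 1)) (hpos (n + 1)).le))) hΦ
  set S : ℝ := ∑ i ∈ Finset.range β, (1 + Φ 0 / ψ) ^ i
  have hW : 0 ≤ (Φ 0 * S) ^ 2 / ψ := by positivity
  refine ⟨1 + (Φ 0 * S) ^ 2 / ψ, by positivity, fun n => ?_⟩
  obtain ⟨hΦn, hΦn_le⟩ := hΦ_bound n
  have hS : 0 ≤ S := by positivity
  have hΨn := hΨ_nonneg n
  have hposn := hpos n
  have hΞ_nonneg : 0 ≤ Ξ n := hΞ n ▸ div_nonneg hΦn hposn.le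
  have hΞ_le : Ξ n ≤ Φ 0 / ψ := by
    rw [hΞ]
    gcongr
    linarith
  have hΥ_le : |Υ n| ≤ Φ 0 * S / (Ψ n + ψ) := by
    calc |Υ n| ≤ Ξ n * S := hΥ n ▸ abs_one_sub_one_sub_pow_le hΞ_nonneg hΞ_le β
      _ = Φ n * S / (Ψ n + ψ) := by rw [hΞ]; ring
      _ ≤ Φ 0 * S / (Ψ n + ψ) := by gcongr
  calc Υ n ^ 2 * Ψ n = |Υ n| ^ 2 * Ψ n := by rw [sq_abs]
    _ ≤ (Φ 0 * S / (Ψ n + ψ)) ^ 2 * (Ψ n + ψ) := by gcongr; linarith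
    _ = (Φ 0 * S) ^ 2 / (Ψ n + ψ) := by field_simp
    _ ≤ (Φ 0 * S) ^ 2 / ψ := by gcongr; linarith
    _ ≤ (1 + (Φ 0 * S) ^ 2 / ψ) ^ 2 := by nlinarith
end

section
/- Let N ≥ 1, let L be an invertible real N×N matrix and set M = L·Lᵀ, and let K be a real symmetric positive semidefinite N×N matrix. Let Δt > 0 and let u, v, f ∈ ℝᴺ and ψ be a real number with ψ ≥ 2·Δt²·‖L⁻¹ f‖². Define Ψ = ½ vᵀ M v + ½ uᵀ K u. Then |vᵀ f| / (Ψ + ψ) ≤ 1/(2Δt); equivalently, |vᵀ f| ≤ (Ψ + ψ)/(2Δt). -/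
open Matrix

/-- The Euclidean norm of a vector in `ℝᴺ`. -/
noncomputable def euclNorm {N : ℕ} (x : Fin N → ℝ) : ℝ :=
  Real.sqrt (x ⬝ᵥ x)

/-- The square of the Euclidean norm is the dot product of the vector with itself. -/
lemma euclNorm_sq {N : ℕ} (x : Fin N → ℝ) : euclNorm x ^ 2 = x ⬝ᵥ x :=
  Real.sq_sqrt (by simpa using dotProduct_star_self_nonneg x)

/-- Young's inequality for the dot product. -/
lemma two_mul_abs_dotProduct_le {n : Type*} [Fintype n] (c : ℝ) (a b : n → ℝ) :
    2 * c * |a ⬝ᵥ b| ≤ a ⬝ᵥ a + c ^ 2 * (b ⬝ᵥ b) := by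
  have key (s : ℝ) : 0 ≤ a ⬝ᵥ a + 2 * s * (a ⬝ᵥ b) + s ^ 2 * (b ⬝ᵥ b) := by
    have h : 0 ≤ (a + s • b) ⬝ᵥ (a + s • b) := by
      simpa using dotProduct_star_self_nonneg (a + s • b)
    simp only [add_dotProduct, dotProduct_add, smul_dotProduct, dotProduct_smul, smul_eq_mul,
      dotProduct_comm b a] at h
    linarith
  rcases abs_cases (a ⬝ᵥ b) with ⟨h, -⟩ | ⟨h, -⟩ <;> rw [h]
  · linarith [key (-c)]
  · linarith [key c]

/-- Central estimate in the proof of Theorem 2: if `ψ ≥ 2Δt²‖L⁻¹f‖²` then the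
power of the nonlinear force is controlled by the shifted pseudo-energy. -/
theorem nonlinear_power_bound
    {N : ℕ} (hN : 1 ≤ N)
    (L : Matrix (Fin N) (Fin N) ℝ) (hL : IsUnit L.det)
    (M : Matrix (Fin N) (Fin N) ℝ) (hM : M = L * Lᵀ)
    (K : Matrix (Fin N) (Fin N) ℝ) (hK : K.PosSemidef)
    (Δt : ℝ) (hΔt : 0 < Δt)
    (u v f : Fin N → ℝ) (ψ : ℝ)
    (hψ : 2 * Δt ^ 2 * (euclNorm (L⁻¹ *ᵥ f)) ^ 2 ≤ ψ)
    (Ψ : ℝ) (hΨ : Ψ = (1/2) * (v ⬝ᵥ M *ᵥ v) + (1/2) * (u ⬝ᵥ K *ᵥ u)) :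
    |v ⬝ᵥ f| / (Ψ + ψ) ≤ 1 / (2 * Δt) ∧ |v ⬝ᵥ f| ≤ (Ψ + ψ) / (2 * Δt) := by
  have hvf : v ⬝ᵥ f = (Lᵀ *ᵥ v) ⬝ᵥ (L⁻¹ *ᵥ f) := by
    rw [mulVec_transpose, ← dotProduct_mulVec, mulVec_mulVec, mul_nonsing_inv L hL, one_mulVec]
  have hvM : v ⬝ᵥ M *ᵥ v = (Lᵀ *ᵥ v) ⬝ᵥ (Lᵀ *ᵥ v) := by
    rw [hM, ← mulVec_mulVec, dotProduct_mulVec, ← mulVec_transpose]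
  have huK : 0 ≤ u ⬝ᵥ K *ᵥ u := by simpa using hK.dotProduct_mulVec_nonneg u
  rw [euclNorm_sq] at hψ
  have hyoung := two_mul_abs_dotProduct_le (2 * Δt) (Lᵀ *ᵥ v) (L⁻¹ *ᵥ f)
  rw [← hvf, ← hvM] at hyoung
  have hbound : |v ⬝ᵥ f| * (2 * Δt) ≤ Ψ + ψ := by
    rw [hΨ]
    linarith
  have hnonneg : 0 ≤ Ψ + ψ := le_trans (by positivity) hbound
  refine ⟨div_le_of_le_mul₀ hnonneg (by positivity) ?_, (le_div_iff₀ (by positivity)).2 hbound⟩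
  rw [one_div_mul_eq_div]
  exact (le_div_iff₀ (by positivity)).2 hbound
end
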